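/- arXiv:2310.12466 — 5 statements merged into one kernel-verified Lean document; each statement's English description precedes it below -/
import Mathlib

section
/- For every c ∈ F, the polynomial f_{c+}(x) = x + c·Σ_{j=1}^{m} x^{j(q-1)} induces a bijective function on K = F_{q^n}; that is, f_{c+} is a permutation polynomial of F_{q^n}. -/
/-- The polynomial map `f_{c+}(x) = x + c * (sum_{j=1}^{m} x^(j(q-1)))` on a field `K`. -/
def fplus (q m : ℕ) {K : Type*} [Field K] (c a : K) : K :=
  a + c * ∑ j ∈ Finset.Icc 1 m, a ^ (j * (q - 1))

/-- On the fixed points of `x ↦ x ^ q` the map `f_{c+}` is the identity. -/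
theorem fplus_eq_self {K : Type*} [Field K] {q m : ℕ} (hq : 1 < q) (hm : (m : K) = 0)
    (c : K) {a : K} (ha : a ^ q = a) : fplus q m c a = a := by
  have hsum : ∑ j ∈ Finset.Icc 1 m, a ^ (j * (q - 1)) = 0 := by
    rcases eq_or_ne a 0 with rfl | h0
    · refine Finset.sum_eq_zero fun j hj => zero_pow ?_
      have := (Finset.mem_Icc.mp hj).1
      exact Nat.mul_ne_zero (by omega) (by omega)
    · have h1 : a ^ (q - 1) = 1 := by
        apply mul_right_cancel₀ h0
        rw [← pow_succ, Nat.sub_add_cancel hq.le, ha, one_mul]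
      simp [mul_comm _ (q - 1), pow_mul, h1, hm]
  rw [fplus, hsum, mul_zero, add_zero]

/-- Off the fixed points of `x ↦ x ^ q` the map `f_{c+}` is translation by `-c`. -/
theorem fplus_eq_sub {K : Type*} [Field K] {q m : ℕ} (hq : 1 < q)
    (c : K) {a : K} (hm : a ^ ((m + 1) * (q - 1)) = 1) (ha : a ^ q ≠ a) :
    fplus q m c a = a - c := by
  have h1 : a ^ (q - 1) ≠ 1 := fun h => ha <| by
    rw [← Nat.sub_add_cancel hq.le, pow_succ, h, one_mul]
  have hgeom : ∑ j ∈ Finset.range (m + 1), (a ^ (q - 1)) ^ j = 0 := by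
    rw [geom_sum_eq h1, ← pow_mul, mul_comm, hm, sub_self, zero_div]
  have hsum : ∑ j ∈ Finset.Icc 1 m, a ^ (j * (q - 1)) = -1 := by
    rw [Finset.range_eq_Ico, Finset.sum_eq_sum_Ico_succ_bot (Nat.succ_pos m), pow_zero] at hgeom
    refine Eq.trans ?_ (neg_eq_of_add_eq_zero_right hgeom).symm
    refine Finset.sum_congr (by ext; simp) fun j _ => ?_
    rw [mul_comm, pow_mul]
  rw [fplus, hsum, mul_neg_one, sub_eq_add_neg]

/-- For every `c ∈ F`, the polynomial `f_{c+}` is a permutation polynomial of `K`. -/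
theorem fplus_bijective (p : ℕ) (hp : p.Prime) (hpodd : Odd p) (e : ℕ) (he : 0 < e)
    (q : ℕ) (hq : q = p ^ e) (n : ℕ) (hn : 2 ≤ n)
    (K : Type*) [Field K] [Fintype K] (hK : Fintype.card K = q ^ n)
    (F : Subfield K) (hF : Nat.card F = q)
    (m : ℕ) (hm : m = ∑ i ∈ Finset.Icc 1 (n - 1), q ^ i)
    (c : K) (hc : c ∈ F) :
    Function.Bijective (fplus q m c) := by
  have : Fact p.Prime := ⟨hp⟩
  have hq1 : 1 < q := hq ▸ Nat.one_lt_pow he.ne' hp.one_lt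
  have : CharP K p := charP_of_card_eq_prime_pow (f := e * n) (by
    rw [hK, hq, pow_mul])
  have hmK : (m : K) = 0 := by
    rw [CharP.cast_eq_zero_iff K p, hm]
    refine Finset.dvd_sum fun i hi => dvd_pow (hq ▸ dvd_pow_self p he.ne') ?_
    have := (Finset.mem_Icc.mp hi).1
    omega
  have hcq : c ^ q = c := by
    have : Fintype F := Fintype.ofFinite F
    have h := FiniteField.pow_card (⟨c, hc⟩ : F)
    rw [← Nat.card_eq_fintype_card, hF] at h
    exact congrArg Subtype.val h
  have hcard : (m + 1) * (q - 1) = Fintype.card K - 1 := by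
    have hm' : m + 1 = ∑ i ∈ Finset.range n, q ^ i := by
      rw [Finset.range_eq_Ico, Finset.sum_eq_sum_Ico_succ_bot (by omega), pow_zero, hm, add_comm]
      congr 1
    have h := geom_sum_mul_add (q - 1) n
    rw [Nat.sub_add_cancel hq1.le] at h
    rw [hm', hK, ← h, Nat.add_sub_cancel]
  have hfix (a : K) : (a - c) ^ q = a - c ↔ a ^ q = a := by
    have hsub : (a - c) ^ q = a ^ q - c ^ q := by rw [hq, sub_pow_char_pow]
    rw [hsub, hcq, sub_left_inj]
  have hoff {a : K} (ha : a ^ q ≠ a) : fplus q m c a = a - c := by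
    have h0 : a ≠ 0 := by
      rintro rfl
      exact ha (zero_pow (by omega))
    exact fplus_eq_sub hq1 c (hcard ▸ FiniteField.pow_card_sub_one_eq_one a h0) ha
  refine Finite.injective_iff_bijective.mp fun a b hab => ?_
  by_cases ha : a ^ q = a <;> by_cases hb : b ^ q = b
  · rwa [fplus_eq_self hq1 hmK c ha, fplus_eq_self hq1 hmK c hb] at hab
  · rw [fplus_eq_self hq1 hmK c ha, hoff hb] at hab
    exact absurd ((hfix b).mp (hab ▸ ha)) hb
  · rw [hoff ha, fplus_eq_self hq1 hmK c hb] at hab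
    exact absurd ((hfix a).mp (hab ▸ hb)) ha
  · rw [hoff ha, hoff hb] at hab
    exact sub_left_injective hab
end

section
/- For every c ∈ F with c ≠ 1, the polynomial f_{c*}(x) = x + c·x·Σ_{j=1}^{m} x^{j(q-1)} induces a bijective function on K = F_{q^n}; that is, f_{c*} is a permutation polynomial of F_{q^n}. -/
/-- The polynomial map `f_{c*}(x) = x + c * x * (sum_{j=1}^{m} x^(j(q-1)))` on a field `K`. -/
def fstar (q m : ℕ) {K : Type*} [Field K] (c a : K) : K :=
  a + c * a * ∑ j ∈ Finset.Icc 1 m, a ^ (j * (q - 1))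

theorem sum_Icc_one_add_zero_term {M : Type*} [AddCommMonoid M] (g : ℕ → M) (k : ℕ) :
    ∑ j ∈ Finset.Icc 1 k, g j + g 0 = ∑ j ∈ Finset.range (k + 1), g j := by
  induction k with
  | zero => simp
  | succ k ih =>
    rw [Finset.sum_Icc_succ_top (by omega), Finset.sum_range_succ, ← ih, add_right_comm]

/-- On elements fixed by the `q`-power map, `fstar` is the identity. -/
theorem fstar_of_pow_eq_self {K : Type*} [Field K] {q m : ℕ} (hq : 1 ≤ q)
    (hm : (m : K) = 0) (c : K) {a : K} (ha : a ^ q = a) : fstar q m c a = a := by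
  rcases eq_or_ne a 0 with rfl | h0
  · simp [fstar]
  have h1 : a ^ (q - 1) = 1 := by
    apply mul_right_cancel₀ h0
    rw [← pow_succ, Nat.sub_add_cancel hq, ha, one_mul]
  have hs : ∀ j ∈ Finset.Icc 1 m, a ^ (j * (q - 1)) = 1 := fun j _ => by
    rw [mul_comm, pow_mul, h1, one_pow]
  simp [fstar, Finset.sum_congr rfl hs, hm]

/-- On elements not fixed by the `q`-power map, `fstar` is multiplication by `1 - c`. -/
theorem fstar_of_pow_ne_self {K : Type*} [Field K] {q m : ℕ} (hq : 1 ≤ q) (c : K) {a : K}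
    (ha : a ^ q ≠ a) (hpow : a ^ ((m + 1) * (q - 1)) = 1) : fstar q m c a = (1 - c) * a := by
  have h1 : a ^ (q - 1) - 1 ≠ 0 := fun h => ha <| by
    rw [← Nat.sub_add_cancel hq, pow_succ, sub_eq_zero.mp h, one_mul]
  have hgeom : ∑ j ∈ Finset.range (m + 1), (a ^ (q - 1)) ^ j = 0 := by
    apply (mul_eq_zero.mp _).resolve_right h1
    rw [geom_sum_mul, ← pow_mul, mul_comm, hpow, sub_self]
  rw [← sum_Icc_one_add_zero_term, pow_zero] at hgeom
  have hs : ∑ j ∈ Finset.Icc 1 m, a ^ (j * (q - 1)) = -1 := by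
    rw [← eq_neg_of_add_eq_zero_left hgeom]
    exact Finset.sum_congr rfl fun j _ => by rw [mul_comm, pow_mul]
  rw [fstar, hs]
  ring

/-- For every `c ∈ F` with `c ≠ 1`, the polynomial `f_{c*}` is a permutation
polynomial of `K`. -/
theorem fstar_bijective (p : ℕ) (hp : p.Prime) (hpodd : Odd p) (e : ℕ) (he : 0 < e)
    (q : ℕ) (hq : q = p ^ e) (n : ℕ) (hn : 2 ≤ n)
    (K : Type*) [Field K] [Fintype K] (hK : Fintype.card K = q ^ n)
    (F : Subfield K) (hF : Nat.card F = q)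
    (m : ℕ) (hm : m = ∑ i ∈ Finset.Icc 1 (n - 1), q ^ i)
    (c : K) (hc : c ∈ F) (hc1 : c ≠ 1) :
    Function.Bijective (fstar q m c) := by
  have hq1 : 1 ≤ q := hq ▸ Nat.one_le_pow _ _ hp.pos
  have hqK : (q : K) = 0 := by
    have h := FiniteField.cast_card_eq_zero K
    rw [hK, Nat.cast_pow] at h
    exact eq_zero_of_pow_eq_zero h
  have hmK : (m : K) = 0 := by
    rw [hm, Nat.cast_sum]
    refine Finset.sum_eq_zero fun i hi => ?_
    rw [Nat.cast_pow, hqK, zero_pow (by have := Finset.mem_Icc.mp hi; omega)]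
  have hexp : (m + 1) * (q - 1) = Fintype.card K - 1 := by
    have hm1 : m + 1 = ∑ i ∈ Finset.range n, q ^ i := by
      have h := sum_Icc_one_add_zero_term (fun i => q ^ i) (n - 1)
      rwa [← hm, Nat.sub_add_cancel (by omega), pow_zero] at h
    rw [hm1, hK, geom_sum_mul_of_one_le hq1]
  have hfix : ∀ a : K, a ^ q = a → fstar q m c a = a := fun a =>
    fstar_of_pow_eq_self hq1 hmK c
  have hmove : ∀ a : K, a ^ q ≠ a → fstar q m c a = (1 - c) * a := fun a ha => by
    refine fstar_of_pow_ne_self hq1 c ha ?_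
    rw [hexp]
    refine FiniteField.pow_card_sub_one_eq_one a ?_
    rintro rfl
    exact ha (zero_pow (by omega))
  have hd0 : 1 - c ≠ 0 := sub_ne_zero.mpr hc1.symm
  have hdq : (1 - c) ^ q = 1 - c := by
    have : Fintype F := Fintype.ofFinite F
    have h := FiniteField.pow_card (1 - ⟨c, hc⟩ : F)
    rw [← Nat.card_eq_fintype_card, hF] at h
    simpa using congrArg (Subtype.val) h
  have hne : ∀ a b : K, a ^ q = a → b ^ q ≠ b → a ≠ (1 - c) * b := by
    rintro _ b ha hb rfl
    rw [mul_pow, hdq] at ha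
    exact hb (mul_left_cancel₀ hd0 ha)
  refine Finite.injective_iff_bijective.mp fun a b hab => ?_
  by_cases ha : a ^ q = a <;> by_cases hb : b ^ q = b
  · rwa [hfix a ha, hfix b hb] at hab
  · rw [hfix a ha, hmove b hb] at hab
    exact absurd hab (hne a b ha hb)
  · rw [hmove a ha, hfix b hb] at hab
    exact absurd hab.symm (hne b a hb ha)
  · rw [hmove a ha, hmove b hb] at hab
    exact mul_left_cancel₀ hd0 hab
end

section
/- For every c ∈ F, the polynomial f_{c+}(x) = x + c·Σ_{j=1}^{m} x^{j(q-1)} is complete to level p − 2: for every integer k with 0 ≤ k ≤ p − 2, the function a ↦ f_{c+}(a) + k·a is a bijection of K. -/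
theorem sum_Icc_pow_eq_neg_one {K : Type*} [Field K] {y : K} {m : ℕ}
    (h : y ^ (m + 1) = 1) (hy : y ≠ 1) : ∑ j ∈ Finset.Icc 1 m, y ^ j = -1 := by
  have h1 : ∑ j ∈ Finset.range (m + 1), y ^ j = 0 := by
    refine (mul_eq_zero.mp ?_).resolve_right (sub_ne_zero.mpr hy)
    rw [geom_sum_mul, h, sub_self]
  rw [Finset.range_eq_Ico, Finset.sum_eq_sum_Ico_succ_bot (Nat.succ_pos m), pow_zero] at h1
  exact eq_neg_of_add_eq_zero_right h1

theorem sum_Icc_pow_add_one (q n : ℕ) (hn : 0 < n) :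
    ∑ i ∈ Finset.Icc 1 (n - 1), q ^ i + 1 = ∑ i ∈ Finset.range n, q ^ i := by
  obtain ⟨n, rfl⟩ := Nat.exists_eq_succ_of_ne_zero hn.ne'
  rw [Finset.range_eq_Ico, Finset.sum_eq_sum_Ico_succ_bot (Nat.succ_pos n), pow_zero, add_comm]
  rfl

theorem fplus_of_pow_eq {K : Type*} [Field K] {q m : ℕ} (hq : 0 < q) (hm : (m : K) = 0)
    (c : K) {a : K} (ha : a ^ q = a) : fplus q m c a = a := by
  rcases eq_or_ne q 1 with rfl | hq1
  · simp [fplus, hm]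
  have h : ∑ j ∈ Finset.Icc 1 m, a ^ (j * (q - 1)) = 0 := by
    rcases eq_or_ne a 0 with rfl | ha0
    · refine Finset.sum_eq_zero fun j hj => zero_pow (mul_ne_zero ?_ ?_)
      · exact (Nat.succ_le_iff.mp (Finset.mem_Icc.mp hj).1).ne'
      · omega
    · have h1 : a ^ (q - 1) = 1 := by
        apply mul_right_cancel₀ ha0
        rw [← pow_succ, Nat.sub_add_cancel hq, ha, one_mul]
      simp [mul_comm _ (q - 1), pow_mul, h1, hm]
  simp [fplus, h]

theorem fplus_of_pow_ne {K : Type*} [Field K] {q m : ℕ} (hq : 0 < q)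
    (c : K) {a : K} (hm : a ^ ((q - 1) * (m + 1)) = 1) (ha : a ^ q ≠ a) :
    fplus q m c a = a - c := by
  have h1 : a ^ (q - 1) ≠ 1 := fun h => ha <| by
    rw [← Nat.sub_add_cancel hq, pow_succ, h, one_mul]
  have h := sum_Icc_pow_eq_neg_one (by rwa [← pow_mul]) h1
  simp_rw [← pow_mul, mul_comm (q - 1)] at h
  simp [fplus, h, sub_eq_add_neg]

/-- `f_{c+}` is complete to level `p - 2`: `f_{c+}(x) + k*x` is a permutation
polynomial for every `0 ≤ k ≤ p - 2`. -/
theorem fplus_complete_level (p : ℕ) (hp : p.Prime) (hpodd : Odd p) (e : ℕ) (he : 0 < e)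
    (q : ℕ) (hq : q = p ^ e) (n : ℕ) (hn : 2 ≤ n)
    (K : Type*) [Field K] [Fintype K] (hK : Fintype.card K = q ^ n)
    (F : Subfield K) (hF : Nat.card F = q)
    (m : ℕ) (hm : m = ∑ i ∈ Finset.Icc 1 (n - 1), q ^ i)
    (c : K) (hc : c ∈ F) :
    ∀ k : ℕ, k ≤ p - 2 →
      Function.Bijective (fun a : K => fplus q m c a + (k : K) * a) := by
  intro k hk
  have hp2 : 2 ≤ p := hp.two_le
  have : Fact p.Prime := ⟨hp⟩
  have : CharP K p := charP_of_card_eq_prime_pow (f := e * n) (by rw [hK, hq, pow_mul])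
  have hq0 : 0 < q := hq ▸ pow_pos hp.pos e
  have hm0 : (m : K) = 0 := by
    have hqK : (q : K) = 0 := by rw [hq, Nat.cast_pow, CharP.cast_eq_zero, zero_pow he.ne']
    rw [hm, Nat.cast_sum]
    refine Finset.sum_eq_zero fun i hi => ?_
    rw [Nat.cast_pow, hqK, zero_pow (by have := Finset.mem_Icc.mp hi; omega)]
  have hexp : (q - 1) * (m + 1) = q ^ n - 1 := by
    have h := geom_sum_mul_add (q - 1) n
    rw [Nat.sub_add_cancel (show 1 ≤ q from hq0)] at h
    rw [hm, sum_Icc_pow_add_one q n (by omega), mul_comm, ← h, Nat.add_sub_cancel]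
  have hcq : c ^ q = c := by
    have : Fintype F := Fintype.ofFinite F
    have h := FiniteField.pow_card (⟨c, hc⟩ : F)
    rw [← Nat.card_eq_fintype_card, hF] at h
    exact congrArg Subtype.val h
  have hk0 : ((k + 1 : ℕ) : K) ≠ 0 := fun h => by
    have := Nat.le_of_dvd k.succ_pos ((CharP.cast_eq_zero_iff K p _).mp h)
    omega
  have hin : ∀ a : K, a ^ q = a → fplus q m c a + k * a = (k + 1 : ℕ) * a := fun a ha => by
    rw [fplus_of_pow_eq hq0 hm0 c ha]; push_cast; ring
  have hout : ∀ a : K, a ^ q ≠ a → fplus q m c a + k * a = (k + 1 : ℕ) * a - c := fun a ha => by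
    have ha0 : a ≠ 0 := by rintro rfl; exact ha (zero_pow hq0.ne')
    rw [fplus_of_pow_ne hq0 c (by rw [hexp, ← hK, FiniteField.pow_card_sub_one_eq_one a ha0]) ha]
    push_cast; ring
  have hmix : ∀ a b : K, a ^ q = a → (k + 1 : ℕ) * a = (k + 1 : ℕ) * b - c → b ^ q = b := by
    intro a b ha h
    have hb : ((k + 1 : ℕ) : K) * b = (k + 1 : ℕ) * a + c := by rw [h]; ring
    have hb' := congrArg (iterateFrobenius K p e) hb
    rw [map_add, map_mul, map_mul, map_natCast] at hb'
    simp only [iterateFrobenius_def, ← hq, ha, hcq] at hb'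
    exact mul_left_cancel₀ hk0 (hb'.trans hb.symm)
  refine Finite.injective_iff_bijective.mp fun a b hab => ?_
  by_cases ha : a ^ q = a <;> by_cases hb : b ^ q = b
  · rw [hin a ha, hin b hb] at hab
    exact mul_left_cancel₀ hk0 hab
  · rw [hin a ha, hout b hb] at hab
    exact absurd (hmix a b ha hab) hb
  · rw [hout a ha, hin b hb] at hab
    exact absurd (hmix b a hb hab.symm) ha
  · rw [hout a ha, hout b hb] at hab
    exact mul_left_cancel₀ hk0 (sub_left_injective hab)
end

section
/- Suppose b ∈ F does not lie in the prime subfield F_p of F, and c ∈ F. Then b·f_{c+}(x) is a maximally complete permutation polynomial of K: for every integer k with 0 ≤ k ≤ p − 1, the function a ↦ b·f_{c+}(a) + k·a is a bijection of K. -/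
/-- The power sum in `fplus` vanishes at the fixed points of `x ↦ x ^ q`. -/
lemma sum_pow_eq_zero_of_pow_eq_self {K : Type*} [Field K] {q m : ℕ} (hq : 2 ≤ q)
    (hm : (m : K) = 0) {a : K} (ha : a ^ q = a) :
    ∑ j ∈ Finset.Icc 1 m, a ^ (j * (q - 1)) = 0 := by
  rcases eq_or_ne a 0 with rfl | h0
  · refine Finset.sum_eq_zero fun j hj => zero_pow ?_
    have := (Finset.mem_Icc.1 hj).1
    exact Nat.mul_ne_zero (by omega) (by omega)
  · have h1 : a ^ (q - 1) = 1 := by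
      refine mul_right_cancel₀ h0 ?_
      rw [← pow_succ, Nat.sub_add_cancel (by omega), ha, one_mul]
    simp [mul_comm _ (q - 1), pow_mul, h1, hm]

/-- The power sum in `fplus` is `-1` away from the fixed points of `x ↦ x ^ q`. -/
lemma sum_pow_eq_neg_one_of_pow_ne_self {K : Type*} [Field K] {q m : ℕ} (hq : 2 ≤ q)
    {a : K} (ha : a ^ q ≠ a) (hpow : a ^ ((q - 1) * (m + 1)) = 1) :
    ∑ j ∈ Finset.Icc 1 m, a ^ (j * (q - 1)) = -1 := by
  have h1 : a ^ (q - 1) - 1 ≠ 0 := by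
    intro h
    apply ha
    rw [← Nat.sub_add_cancel (show 1 ≤ q by omega), pow_succ, sub_eq_zero.1 h, one_mul]
  have hgeom : ∑ j ∈ Finset.range (m + 1), (a ^ (q - 1)) ^ j = 0 := by
    refine (mul_eq_zero.1 ?_).resolve_right h1
    rw [geom_sum_mul, ← pow_mul, hpow, sub_self]
  rw [Finset.range_eq_Ico, Finset.sum_eq_sum_Ico_succ_bot (by omega), pow_zero] at hgeom
  rw [eq_neg_iff_add_eq_zero, add_comm, ← hgeom]
  congr 1
  refine Finset.sum_congr ?_ fun j _ => by rw [← pow_mul, mul_comm]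
  ext j
  simp only [Finset.mem_Icc, Finset.mem_Ico]
  omega

/-- Scaling by a nonzero fixed point of the `p ^ e`-Frobenius, and translating the points that
are not fixed by a fixed point, is injective. -/
lemma injective_of_translate_off_fixed {K : Type*} [Field K] {p e : ℕ} [Fact p.Prime] [CharP K p]
    {u v : K} (hu0 : u ≠ 0) (hu : u ^ p ^ e = u) (hv : v ^ p ^ e = v) {g : K → K}
    (hg : ∀ a, a ^ p ^ e = a → g a = u * a) (hg' : ∀ a, a ^ p ^ e ≠ a → g a = u * a - v) :
    Function.Injective g := by
  have mixed : ∀ a a' : K, a ^ p ^ e = a → a' ^ p ^ e ≠ a' → g a ≠ g a' := by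
    intro a a' ha ha' h
    rw [hg a ha, hg' a' ha'] at h
    apply ha'
    have h' : a' = a + v / u := by
      field_simp
      linear_combination -h
    rw [h', add_pow_char_pow, div_pow, ha, hu, hv]
  intro a a' h
  by_cases ha : a ^ p ^ e = a <;> by_cases ha' : a' ^ p ^ e = a'
  · rw [hg a ha, hg a' ha'] at h
    exact mul_left_cancel₀ hu0 h
  · exact absurd h (mixed a a' ha ha')
  · exact absurd h.symm (mixed a' a ha' ha)
  · rw [hg' a ha, hg' a' ha'] at h
    exact mul_left_cancel₀ hu0 (sub_left_injective h)

/-- If `b ∈ F` is not in the prime subfield, then `b * f_{c+}` is maximally complete: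
`b * f_{c+}(x) + k*x` is a permutation polynomial for every `0 ≤ k ≤ p - 1`. -/
theorem fplus_maximally_complete (p : ℕ) (hp : p.Prime) (hpodd : Odd p) (e : ℕ) (he : 0 < e)
    (q : ℕ) (hq : q = p ^ e) (n : ℕ) (hn : 2 ≤ n)
    (K : Type*) [Field K] [Fintype K] (hK : Fintype.card K = q ^ n)
    (F : Subfield K) (hF : Nat.card F = q)
    (m : ℕ) (hm : m = ∑ i ∈ Finset.Icc 1 (n - 1), q ^ i)
    (b : K) (hb : b ∈ F) (hbp : b ∉ (⊥ : Subfield K))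
    (c : K) (hc : c ∈ F) :
    ∀ k : ℕ, k ≤ p - 1 →
      Function.Bijective (fun a : K => b * fplus q m c a + (k : K) * a) := by
  intro k _
  have : Fact p.Prime := ⟨hp⟩
  have hq2 : 2 ≤ q := by
    rw [hq]
    exact hp.two_le.trans (Nat.le_self_pow he.ne' p)
  have : CharP K p := charP_of_card_eq_prime_pow (f := e * n) (by
    rw [hK, hq, pow_mul])
  have hqK : (q : K) = 0 := by
    rw [hq, Nat.cast_pow, CharP.cast_eq_zero, zero_pow he.ne']
  have hmK : (m : K) = 0 := by
    rw [hm, Nat.cast_sum]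
    refine Finset.sum_eq_zero fun i hi => ?_
    have := (Finset.mem_Icc.1 hi).1
    rw [Nat.cast_pow, hqK, zero_pow (by omega)]
  have hexp : (q - 1) * (m + 1) = q ^ n - 1 := by
    have hm1 : m + 1 = ∑ i ∈ Finset.range n, q ^ i := by
      rw [Finset.range_eq_Ico, Finset.sum_eq_sum_Ico_succ_bot (by omega), pow_zero, hm, add_comm]
      congr 1
    rw [hm1, mul_comm, Nat.geomSum_eq hq2, Nat.div_mul_cancel (Nat.sub_one_dvd_pow_sub_one q n)]
  have hfix : ∀ x ∈ F, x ^ p ^ e = x := by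
    intro x hx
    have := Fintype.ofFinite F
    have h := FiniteField.pow_card (⟨x, hx⟩ : F)
    rw [← Nat.card_eq_fintype_card, hF, hq] at h
    exact congrArg Subtype.val h
  have hkF : ∀ L : Subfield K, (k : K) ∈ L := fun L => natCast_mem L k
  refine Finite.injective_iff_bijective.1 (injective_of_translate_off_fixed (p := p) (e := e)
    (u := b + k) (v := b * c) ?_ (hfix _ (F.add_mem hb (hkF F))) (hfix _ (F.mul_mem hb hc)) ?_ ?_)
  · intro h
    apply hbp
    rw [eq_neg_of_add_eq_zero_left h]
    exact neg_mem (hkF ⊥)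
  · intro a ha
    rw [← hq] at ha
    simp only [fplus, sum_pow_eq_zero_of_pow_eq_self hq2 hmK ha]
    ring
  · intro a ha
    rw [← hq] at ha
    have ha0 : a ≠ 0 := by
      rintro rfl
      exact ha (zero_pow (by omega))
    have hpow : a ^ ((q - 1) * (m + 1)) = 1 := by
      rw [hexp, ← hK, FiniteField.pow_card_sub_one_eq_one a ha0]
    simp only [fplus, sum_pow_eq_neg_one_of_pow_ne_self hq2 ha hpow]
    ring
end

section
/- For all c, d ∈ F, the composition of the functions induced on K satisfies f_{c+} ∘ f_{d+} = f_{(c+d)+}; consequently the map sending c ∈ F to the permutation of K induced by f_{c+} is an injective group homomorphism from the additive group of F into the symmetric group of K, so {f_{c+} : c ∈ F} is an abelian group under composition isomorphic to (F, +). -/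
/-- The exponent `q + q^2 + ⋯ + q^(n-1)` satisfies `m (q - 1) + q = q^n`. -/
theorem sum_Icc_pow_mul_pred_add (q n : ℕ) (hq : 1 ≤ q) (hn : 1 ≤ n) :
    (∑ i ∈ Finset.Icc 1 (n - 1), q ^ i) * (q - 1) + q = q ^ n := by
  obtain ⟨k, rfl⟩ : ∃ k, n = k + 1 := ⟨n - 1, by omega⟩
  obtain ⟨r, rfl⟩ : ∃ r, q = r + 1 := ⟨q - 1, by omega⟩
  simp only [Nat.add_sub_cancel]
  induction k with
  | zero => simp
  | succ k ih =>
    rw [Finset.sum_Icc_succ_top (by omega)]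
    linear_combination ih (by omega)

/-- A sum `u + u^2 + ⋯ + u^m` multiplied by `u - 1` telescopes. -/
theorem sum_Icc_pow_mul_sub_one {R : Type*} [CommRing R] (u : R) (m : ℕ) :
    (∑ j ∈ Finset.Icc 1 m, u ^ j) * (u - 1) = u ^ (m + 1) - u := by
  induction m with
  | zero => simp
  | succ k ih =>
    rw [Finset.sum_Icc_succ_top (by omega), add_mul, ih]
    ring

/-- The map `f_{c+}` fixes the solutions of `a^q = a` and translates every other element by `-c`. -/
theorem fplus_eq_ite {K : Type*} [Field K] [DecidableEq K] (q m : ℕ) (hq : 2 ≤ q)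
    (hm : (m : K) = 0) (hpow : ∀ a : K, a ^ (m * (q - 1) + q) = a) (c a : K) :
    fplus q m c a = if a ^ q = a then a else a - c := by
  unfold fplus
  have hq1 : a ^ q = a ^ (q - 1) * a := by
    rw [← pow_succ, Nat.sub_add_cancel (by omega)]
  by_cases ha : a = 0
  · subst ha
    rw [Finset.sum_eq_zero, if_pos (zero_pow (by omega)), mul_zero, add_zero]
    intro j hj
    have := (Finset.mem_Icc.mp hj).1
    exact zero_pow (Nat.mul_ne_zero (by omega) (by omega))
  · have hsum : ∑ j ∈ Finset.Icc 1 m, a ^ (j * (q - 1)) =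
        ∑ j ∈ Finset.Icc 1 m, (a ^ (q - 1)) ^ j :=
      Finset.sum_congr rfl fun j _ => by rw [← pow_mul, mul_comm]
    rw [hsum]
    split_ifs with h
    · have hu : a ^ (q - 1) = 1 := mul_right_cancel₀ ha (by rw [← hq1, h, one_mul])
      simp [hu, hm]
    · have hu : a ^ (q - 1) - 1 ≠ 0 := fun h0 => h (by rw [hq1, sub_eq_zero.mp h0, one_mul])
      have hum : (a ^ (q - 1)) ^ (m + 1) = 1 := by
        refine mul_right_cancel₀ ha ?_
        rw [one_mul, pow_succ, mul_assoc, ← hq1, ← pow_mul, mul_comm (q - 1), ← pow_add, hpow]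
      have hneg : ∑ j ∈ Finset.Icc 1 m, (a ^ (q - 1)) ^ j = -1 := by
        refine mul_right_cancel₀ hu ?_
        rw [sum_Icc_pow_mul_sub_one, hum]
        ring
      rw [hneg]
      ring

/-- A finite field with more than `q ≥ 2` elements contains a non-solution of `a^q = a`. -/
theorem exists_pow_ne_self {K : Type*} [Field K] [Fintype K] (q : ℕ) (hq : 1 < q)
    (hK : q < Fintype.card K) : ∃ a : K, a ^ q ≠ a := by
  by_contra! h
  refine FiniteField.X_pow_card_sub_X_ne_zero K hq
    (Polynomial.eq_zero_of_natDegree_lt_card_of_eval_eq_zero' _ Finset.univ (fun a _ => ?_) ?_)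
  · simp [h a]
  · rwa [FiniteField.X_pow_card_sub_X_natDegree_eq K hq, Finset.card_univ]

/-- `f_{c+} ∘ f_{d+} = f_{(c+d)+}`, and `c ↦ f_{c+}` gives an injective group
homomorphism from the additive group of `F` into the symmetric group of `K`. -/
theorem fplus_group_structure (p : ℕ) (hp : p.Prime) (hpodd : Odd p) (e : ℕ) (he : 0 < e)
    (q : ℕ) (hq : q = p ^ e) (n : ℕ) (hn : 2 ≤ n)
    (K : Type*) [Field K] [Fintype K] (hK : Fintype.card K = q ^ n)
    (F : Subfield K) (hF : Nat.card F = q)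
    (m : ℕ) (hm : m = ∑ i ∈ Finset.Icc 1 (n - 1), q ^ i)
    (hbij : ∀ c : F, Function.Bijective (fplus q m (c : K))) :
    (∀ c d : F, (fplus q m (c : K)) ∘ (fplus q m (d : K)) = fplus q m ((c : K) + (d : K))) ∧
    ∃ Φ : F → Equiv.Perm K, Function.Injective Φ ∧
      (∀ c : F, ⇑(Φ c) = fplus q m (c : K)) ∧
      (∀ c d : F, Φ (c + d) = Φ c * Φ d) := by
  classical
  have : Fact p.Prime := ⟨hp⟩
  have hq2 : 1 < q := hq ▸ Nat.one_lt_pow he.ne' hp.one_lt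
  have : CharP K p := charP_of_card_eq_prime_pow (f := e * n) (by
    rw [hK, hq, pow_mul])
  have hm0 : (m : K) = 0 := by
    rw [CharP.cast_eq_zero_iff K p, hm]
    refine Finset.dvd_sum fun i hi => ?_
    have := (Finset.mem_Icc.mp hi).1
    exact (hq ▸ dvd_pow_self p he.ne' : p ∣ q).trans (dvd_pow_self q (by omega))
  have hpow (a : K) : a ^ (m * (q - 1) + q) = a := by
    rw [hm, sum_Icc_pow_mul_pred_add q n hq2.le (by omega), ← hK, FiniteField.pow_card]
  have hf := fplus_eq_ite (K := K) q m hq2 hm0 hpow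
  have hFq (c : F) : (c : K) ^ q = c := by
    have : Fintype F := Fintype.ofFinite F
    have h := FiniteField.pow_card c
    rw [← Nat.card_eq_fintype_card, hF] at h
    exact_mod_cast congrArg Subtype.val h
  have hcomp (c d : F) :
      fplus q m (c : K) ∘ fplus q m (d : K) = fplus q m ((c : K) + (d : K)) := by
    funext a
    have hsub : (a - (d : K)) ^ q = a ^ q - d := by
      conv_rhs => rw [← hFq d]
      rw [hq, sub_pow_char_pow]
    simp only [Function.comp_apply, hf]
    by_cases h : a ^ q = a
    · simp [h]
    · simp only [h, if_false, hsub, sub_left_inj]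
      ring
  refine ⟨hcomp, fun c => Equiv.ofBijective _ (hbij c), fun c d hcd => ?_, fun c => rfl,
    fun c d => Equiv.ext fun a => (congrFun (hcomp c d) a).symm⟩
  obtain ⟨a, ha⟩ := exists_pow_ne_self (K := K) q hq2
    (hK ▸ lt_self_pow₀ hq2 (by omega))
  have h : fplus q m (c : K) a = fplus q m (d : K) a := congrArg (fun σ : Equiv.Perm K => σ a) hcd
  simpa [hf, ha] using h
end
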